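/- Let S be a commutative ℚ-algebra, φ: S → R a ring morphism, W ∈ S, and (X,d_X) a finite rank matrix factorisation of φ(W) over R with fixed homogeneous basis. Let t = (t₁,…,tₙ) be a quasi-regular sequence in R with R/tR finitely generated projective over S, suppose each tⱼ·1_X is null-homotopic with chosen odd R-linear homotopy λⱼ (λⱼd_X + d_Xλⱼ = tⱼ·1_X), and suppose R admits a standard flat S-linear connection ∇⁰: R → R⊗_{S[t]}Ω¹_{S[t]/S} with Ker(∇⁰) + tR = R. Then in the homotopy category of linear factorisations of W over S there are morphisms ψ: X/tX → φ_*(X)[n] and θ: φ_*(X)[n] → X/tX with ψ∘θ = 1, and the idempotent θ∘ψ on X/tX is e = (1/n!)·(−1)^{n(n+1)/2}·λ₁⋯λₙ ∘ At_{S[t]/S}(X)ⁿ, where At_{S[t]/S}(X)ⁿ is the n-th power of the Atiyah class of X relative to S[t]/S, trivialised by dt₁∧⋯∧dtₙ, regarded as an S-linear endomorphism of X/tX. In particular the n-fold suspension of φ_*(X) is a direct summand of X/tX in the homotopy category of linear factorisations of W over S. -/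

import Mathlib

/-!
STATEMENT 11 (the main pushforward theorem).

Conventions.  A finite rank matrix factorisation `X` of `φ(W)` over `R` with fixed
homogeneous basis is `ι → R` with parity function `par`; grading involution `gX`, odd
maps anticommute with it, `d² = φ(W)·1`.  `X/tX = ι → R/tR`, with differential and
grading the reductions of `d` and `gX`; `φ_*(X)[n]` is `ι → R` viewed over `S`, with
differential `(-1)ⁿd` and grading `(-1)ⁿgX`.  Morphisms in the homotopy category are
even `S`-linear chain maps up to homotopy (`f ≃ g` iff `f - g = Dh + hD`).  `S[t]` maps
to `R` by `tᵢ ↦ u i`; a connection is encoded by components `∂ⱼ : R →ₗ[S] R` (Leibniz: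
`∂ⱼ(uᵢ r) = uᵢ∂ⱼr + δᵢⱼ r`, flat: the `∂ⱼ` commute), `δ∇⁰ = Σᵢ uᵢ∂ᵢ`; standard means
`p·1 + δ∇⁰` is bijective and identifies `tR` with `tR` for `p > 0` and `Im(δ∇⁰) = tR`.
The `n`-th power of the Atiyah class of `X` relative to `S[t]/S`, trivialised by
`dt₁∧⋯∧dtₙ`, is the `S[t]`-linear degree-`n` map
`Atⁿ = (-1)ⁿ Σ_{τ∈Sₙ} sgn(τ)[∂_{τ(1)},d]⋯[∂_{τ(n)},d]` (the paper's expansion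
(eq:atiyahnexpanded)); as an `S`-linear endomorphism of `X/tX` it is built from the
descended commutators `C j a` characterised below.  Quasi-regularity is the classical
coefficient condition.
-/

namespace Stmt11

def IsQuasiRegular {R : Type*} [CommRing R] {n : ℕ} (u : Fin n → R) : Prop :=
  ∀ (k : ℕ) (F : MvPolynomial (Fin n) R), F.IsHomogeneous k →
    MvPolynomial.eval u F ∈ (Ideal.span (Set.range u)) ^ (k + 1) →
    ∀ m, MvPolynomial.coeff m F ∈ Ideal.span (Set.range u)

def gX (R : Type*) [CommRing R] {ι : Type*} [Fintype ι] [DecidableEq ι]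
    (par : ι → Bool) : Module.End R (ι → R) :=
  LinearMap.pi fun i => (if par i then (-1 : R) else 1) • LinearMap.proj i

def dmat {R : Type*} [CommRing R] {ι : Type*} [Fintype ι] [DecidableEq ι]
    (d : Module.End R (ι → R)) (a b : ι) : R :=
  d (Pi.single b 1) a

def matExt {R M : Type*} [CommRing R] [AddCommGroup M] [Module R M]
    {ι : Type*} [Fintype ι] [DecidableEq ι] (A : ι → ι → R) :
    (ι → M) →ₗ[R] (ι → M) :=
  LinearMap.pi fun a => ∑ b, A a b • LinearMap.proj b

/-- `δ∇⁰ = Σᵢ uᵢ·∂ᵢ` on `R`. -/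
def delNabla0 {S R : Type*} [CommRing S] [CommRing R] [Algebra S R] {n : ℕ}
    (u : Fin n → R) (dd : Fin n → (R →ₗ[S] R)) : R →ₗ[S] R :=
  ∑ i : Fin n, LinearMap.mulLeft S (u i) ∘ₗ dd i

end Stmt11

namespace Stmt11

section Forms

variable {S : Type*} [CommRing S] {n : ℕ}
  {M : Type*} [AddCommGroup M] [Module S M]

/-- The sign picked up when `dtⱼ` is moved past the `dtᵢ` with `i ∈ I`, `i < j`. -/
def ksign (j : Fin n) (I : Finset (Fin n)) : ℤ := ∏ i ∈ I, if i < j then -1 else 1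

theorem ksign_insert {i j : Fin n} {I : Finset (Fin n)} (h : i ∉ I) :
    ksign j (insert i I) = (if i < j then -1 else 1) * ksign j I :=
  Finset.prod_insert h

theorem ksign_insert_self (j : Fin n) (I : Finset (Fin n)) :
    ksign j (insert j I) = ksign j I := by
  by_cases h : j ∈ I
  · rw [Finset.insert_eq_of_mem h]
  · rw [ksign_insert h, if_neg (lt_irrefl j), one_mul]

theorem ksign_erase {i j : Fin n} {I : Finset (Fin n)} (h : i ∈ I) :
    ksign j I = (if i < j then -1 else 1) * ksign j (I.erase i) := by
  conv_lhs => rw [← Finset.insert_erase h]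
  exact ksign_insert (Finset.notMem_erase i I)

theorem ksign_erase_self (j : Fin n) (I : Finset (Fin n)) :
    ksign j (I.erase j) = ksign j I := by
  by_cases h : j ∈ I
  · rw [ksign_erase h, if_neg (lt_irrefl j), one_mul]
  · rw [Finset.erase_eq_of_notMem h]

theorem ksign_mul_self (j : Fin n) (I : Finset (Fin n)) : ksign j I * ksign j I = 1 := by
  rw [ksign, ← Finset.prod_mul_distrib]
  exact Finset.prod_eq_one fun i _ => by split_ifs <;> rfl

variable (S) in
/-- Exterior multiplication by `dtⱼ` on `M`-valued forms, a form being the family of its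
coefficients at the `dt_I`. -/
def wedge (j : Fin n) : Module.End S (Finset (Fin n) → M) where
  toFun f I := if j ∈ I then ksign j I • f (I.erase j) else 0
  map_add' f g := by ext I; dsimp; split_ifs <;> simp
  map_smul' s f := by ext I; dsimp; split_ifs <;> simp [smul_comm (_ : ℤ) s]

variable (S) in
/-- Contraction with the dual of `dtⱼ` on `M`-valued forms. -/
def contr (j : Fin n) : Module.End S (Finset (Fin n) → M) where
  toFun f I := if j ∈ I then 0 else ksign j I • f (insert j I)
  map_add' f g := by ext I; dsimp; split_ifs <;> simp
  map_smul' s f := by ext I; dsimp; split_ifs <;> simp [smul_comm (_ : ℤ) s]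

/-- The operator acting on forms of degree `k` through `A k` on coefficients. -/
def diag (A : ℕ → Module.End S M) : Module.End S (Finset (Fin n) → M) where
  toFun f I := A I.card (f I)
  map_add' f g := by ext I; simp
  map_smul' s f := by ext I; simp

theorem wedge_apply (j : Fin n) (f : Finset (Fin n) → M) (I : Finset (Fin n)) :
    wedge S j f I = if j ∈ I then ksign j I • f (I.erase j) else 0 := rfl

theorem contr_apply (j : Fin n) (f : Finset (Fin n) → M) (I : Finset (Fin n)) :
    contr S j f I = if j ∈ I then 0 else ksign j I • f (insert j I) := rfl

theorem diag_apply (A : ℕ → Module.End S M) (f : Finset (Fin n) → M) (I : Finset (Fin n)) :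
    diag A f I = A I.card (f I) := rfl

/-- Multiplication by the operator-valued one-form `∑ⱼ dtⱼ cⱼ`. -/
def oneForm (c : Fin n → Module.End S M) : Module.End S (Finset (Fin n) → M) :=
  ∑ j, wedge S j * diag fun _ => c j

theorem oneForm_apply (c : Fin n → Module.End S M) (f : Finset (Fin n) → M)
    (I : Finset (Fin n)) :
    oneForm c f I = ∑ j, if j ∈ I then ksign j I • c j (f (I.erase j)) else 0 := by
  rw [oneForm, LinearMap.sum_apply, Finset.sum_apply]
  rfl

theorem wedge_mul_self (j : Fin n) :
    (wedge S j * wedge S j : Module.End S (Finset (Fin n) → M)) = 0 := by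
  refine LinearMap.ext fun f => funext fun I => ?_
  simp [wedge_apply]

theorem contr_mul_self (j : Fin n) :
    (contr S j * contr S j : Module.End S (Finset (Fin n) → M)) = 0 := by
  refine LinearMap.ext fun f => funext fun I => ?_
  simp [contr_apply]

theorem wedge_mul_wedge (i j : Fin n) :
    (wedge S i * wedge S j : Module.End S (Finset (Fin n) → M)) = -(wedge S j * wedge S i) := by
  rcases eq_or_ne i j with rfl | hij
  · simp [wedge_mul_self]
  refine LinearMap.ext fun f => funext fun I => ?_
  simp only [Module.End.mul_apply, LinearMap.neg_apply, Pi.neg_apply, wedge_apply,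
    Finset.mem_erase]
  by_cases hi : i ∈ I <;> by_cases hj : j ∈ I <;> simp [hi, hj, hij, hij.symm]
  rw [Finset.erase_right_comm, smul_smul, smul_smul, ← neg_smul, ksign_erase hj (j := i),
    ksign_erase hi (j := j)]
  congr 1
  rcases lt_or_gt_of_ne hij with h | h <;> simp [h, h.not_gt] <;> ring

theorem contr_mul_contr (i j : Fin n) :
    (contr S i * contr S j : Module.End S (Finset (Fin n) → M)) = -(contr S j * contr S i) := by
  rcases eq_or_ne i j with rfl | hij
  · simp [contr_mul_self]
  refine LinearMap.ext fun f => funext fun I => ?_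
  simp only [Module.End.mul_apply, LinearMap.neg_apply, Pi.neg_apply, contr_apply,
    Finset.mem_insert]
  by_cases hi : i ∈ I <;> by_cases hj : j ∈ I <;> simp [hi, hj, hij, hij.symm]
  rw [Finset.insert_comm, smul_smul, smul_smul, ← neg_smul, ksign_insert hj, ksign_insert hi]
  congr 1
  rcases lt_or_gt_of_ne hij with h | h <;> simp [h, h.not_gt] <;> ring

theorem contr_mul_wedge (i j : Fin n) :
    (contr S i * wedge S j : Module.End S (Finset (Fin n) → M)) =
      (if i = j then 1 else 0) - wedge S j * contr S i := by
  rcases eq_or_ne i j with rfl | hij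
  · refine LinearMap.ext fun f => funext fun I => ?_
    by_cases hi : i ∈ I
    · simp [contr_apply, wedge_apply, hi, smul_smul, ksign_erase_self, ksign_mul_self]
    · simp [contr_apply, wedge_apply, hi, smul_smul, ksign_insert_self, ksign_mul_self]
  refine LinearMap.ext fun f => funext fun I => ?_
  simp only [Module.End.mul_apply, if_neg hij, zero_sub, LinearMap.neg_apply, Pi.neg_apply,
    contr_apply, wedge_apply, Finset.mem_erase, Finset.mem_insert]
  by_cases hi : i ∈ I <;> by_cases hj : j ∈ I <;> simp [hi, hj, hij, hij.symm]
  rw [Finset.erase_insert_of_ne hij, smul_smul, smul_smul, ← neg_smul, ksign_insert hi,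
    ksign_erase hj (j := i)]
  congr 1
  rcases lt_or_gt_of_ne hij with h | h <;> simp [h, h.not_gt] <;> ring

theorem diag_mul_wedge (A : ℕ → Module.End S M) (j : Fin n) :
    diag A * wedge S j = wedge S j * diag (fun k => A (k + 1)) := by
  refine LinearMap.ext fun f => funext fun I => ?_
  simp only [Module.End.mul_apply, diag_apply, wedge_apply]
  split_ifs with h
  · rw [Finset.card_erase_add_one h, map_zsmul]
  · simp

theorem contr_mul_diag (A : ℕ → Module.End S M) (j : Fin n) :
    contr S j * diag A = diag (fun k => A (k + 1)) * contr S j := by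
  refine LinearMap.ext fun f => funext fun I => ?_
  simp only [Module.End.mul_apply, diag_apply, contr_apply]
  split_ifs with h
  · simp
  · rw [Finset.card_insert_of_notMem h, map_zsmul]

theorem diag_mul_diag (A B : ℕ → Module.End S M) :
    (diag A * diag B : Module.End S (Finset (Fin n) → M)) = diag (fun k => A k * B k) := rfl

theorem sum_wedge_mul_contr :
    (∑ i : Fin n, wedge S i * contr S i : Module.End S (Finset (Fin n) → M)) =
      diag (fun k => (k : Module.End S M)) := by
  refine LinearMap.ext fun f => funext fun I => ?_
  have h : ∀ i, wedge S i (contr S i f) I = if i ∈ I then f I else 0 := fun i => by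
    by_cases hi : i ∈ I
    · simp [wedge_apply, contr_apply, hi, smul_smul, ksign_erase_self, ksign_mul_self]
    · simp [wedge_apply, hi]
  simp [LinearMap.sum_apply, Finset.sum_apply, h, diag_apply]

end Forms

section RingIdentities

variable {E : Type*} [Ring E]

theorem sum_mul_sum_self_eq_zero {ι : Type*} (s : Finset ι) (a : ι → E)
    (hsq : ∀ i, a i * a i = 0) (hanti : ∀ i j, a i * a j = -(a j * a i)) :
    (∑ i ∈ s, a i) * ∑ i ∈ s, a i = 0 := by
  classical
  induction s using Finset.induction_on with
  | empty => simp
  | insert i s hi ih =>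
    have h : a i * ∑ j ∈ s, a j = -((∑ j ∈ s, a j) * a i) := by
      rw [Finset.mul_sum, Finset.sum_mul, ← Finset.sum_neg_distrib]
      exact Finset.sum_congr rfl fun j _ => hanti i j
    rw [Finset.sum_insert hi, add_mul, mul_add, mul_add, ih, hsq, h]
    abel

/-- The hypotheses under which a Koszul type differential `δ` with a connection `nab` has
`G * nab` as a contracting homotopy onto `p`. -/
structure IsContraction (δ nab G p : E) : Prop where
  δ_δ : δ * δ = 0
  nab_nab : nab * nab = 0
  G_lap : G * (nab * δ + δ * nab) = 1 - p
  lap_G : (nab * δ + δ * nab) * G = 1 - p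
  p_nab : p * nab = 0
  δ_p : δ * p = 0
  p_G : p * G = 0
  G_p : G * p = 0

namespace IsContraction

variable {δ nab G p : E}

theorem nab_G (h : IsContraction δ nab G p) : nab * G = G * nab * (1 - p) := by
  have h1 : nab * (nab * δ + δ * nab) = (nab * δ + δ * nab) * nab := by
    simp only [mul_add, add_mul, mul_assoc, h.nab_nab, mul_zero]
    simp only [← mul_assoc, h.nab_nab, zero_mul, zero_add, add_zero]
  have h2 : G * (nab * (nab * δ + δ * nab)) * G = G * nab * (1 - p) := by
    rw [← h.lap_G]; simp only [mul_assoc]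
  rw [← h2, h1, ← mul_assoc, h.G_lap, sub_mul, one_mul, h.p_nab, sub_zero]

theorem G_δ (h : IsContraction δ nab G p) : G * δ = (1 - p) * (δ * G) := by
  have h1 : δ * (nab * δ + δ * nab) = (nab * δ + δ * nab) * δ := by
    simp only [mul_add, add_mul, mul_assoc, h.δ_δ, mul_zero]
    simp only [← mul_assoc, h.δ_δ, zero_mul, zero_add, add_zero]
  have h2 : G * ((nab * δ + δ * nab) * δ) * G = (1 - p) * (δ * G) := by
    rw [← h.G_lap]; simp only [mul_assoc]
  rw [← h2, ← h1, mul_assoc, mul_assoc, h.lap_G, mul_sub, h.δ_p, mul_one, sub_zero]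

theorem nab_G_nab (h : IsContraction δ nab G p) : nab * G * nab = 0 := by
  rw [h.nab_G, mul_assoc, sub_mul, one_mul, h.p_nab, sub_zero, mul_assoc, h.nab_nab, mul_zero]

theorem H_H (h : IsContraction δ nab G p) : G * nab * (G * nab) = 0 := by
  rw [mul_assoc, ← mul_assoc nab, h.nab_G_nab, mul_zero]

theorem proj_eq (h : IsContraction δ nab G p) :
    1 - δ * (G * nab) - G * nab * δ = p * (1 - δ * (G * nab)) := by
  have h1 : G * nab * δ = 1 - p - G * δ * nab := by
    rw [← h.G_lap]; noncomm_ring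
  rw [h1, h.G_δ]; noncomm_ring

theorem proj_δ (h : IsContraction δ nab G p) : (1 - δ * (G * nab) - G * nab * δ) * δ = 0 := by
  have h1 : (1 - δ * (G * nab) - G * nab * δ) * δ =
      δ * (1 - δ * (G * nab) - G * nab * δ) := by
    simp only [sub_mul, mul_sub, mul_assoc, h.δ_δ, mul_zero]
    simp only [← mul_assoc, h.δ_δ, zero_mul]
    noncomm_ring
  rw [h1, h.proj_eq, ← mul_assoc, h.δ_p, zero_mul]

theorem proj_nab (h : IsContraction δ nab G p) : (1 - δ * (G * nab) - G * nab * δ) * nab = 0 := by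
  rw [h.proj_eq, mul_assoc, sub_mul, one_mul, mul_assoc, mul_assoc, h.nab_nab]
  simp [h.p_nab]

theorem nab_proj (h : IsContraction δ nab G p) : nab * (1 - δ * (G * nab) - G * nab * δ) = 0 := by
  have h1 : nab * (1 - δ * (G * nab) - G * nab * δ) =
      nab - ((nab * δ + δ * nab) * G) * nab + δ * (nab * G * nab) - nab * G * nab * δ := by
    noncomm_ring
  rw [h1, h.lap_G, h.nab_G_nab, sub_mul, h.p_nab]; simp

theorem proj_p (h : IsContraction δ nab G p) :
    (1 - δ * (G * nab) - G * nab * δ) * p = 1 - δ * (G * nab) - G * nab * δ := by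
  have h1 : (1 - δ * (G * nab) - G * nab * δ) * (1 - p) = 0 := by
    have h2 : ∀ e : E, e * ((nab * δ + δ * nab) * G) = e * nab * δ * G + e * δ * nab * G :=
      fun e => by noncomm_ring
    rw [← h.lap_G, h2, h.proj_nab, h.proj_δ]
    simp
  rw [mul_sub, mul_one, sub_eq_zero] at h1
  exact h1.symm

theorem proj_H (h : IsContraction δ nab G p) :
    (1 - δ * (G * nab) - G * nab * δ) * (G * nab) = 0 := by
  rw [h.proj_eq, mul_assoc, sub_mul, one_mul, mul_assoc, h.H_H, mul_zero, sub_zero,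
    ← mul_assoc, h.p_G, zero_mul]

end IsContraction

/-- The homological perturbation lemma, for a perturbation `b` of `δ` and a contracting
homotopy `H` of `δ`. -/
theorem perturbation {δ b H e Z w : E} (he : e = 1 - δ * H - H * δ) (hHH : H * H = 0)
    (heH : e * H = 0) (heδ : e * δ = 0) (hebH : e * b * H = 0) (hZ : (1 + H * b) * Z = 1)
    (hZ' : Z * (1 + H * b) = 1) (hw : (δ + b) * (δ + b) = w) (hwH : H * w = w * H) :
    1 - Z * e = (δ + b) * (Z * H) + Z * H * (δ + b) := by
  have hK : (1 + H * b) * (Z * H) = H := by rw [← mul_assoc, hZ, one_mul]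
  have hHbK : H * b * (Z * H) = H - Z * H := by
    rw [add_mul, one_mul] at hK; exact eq_sub_of_add_eq' hK
  have hKeq : Z * H = H - H * b * (Z * H) := by rw [hHbK]; abel
  have hHK : H * (Z * H) = 0 := by
    rw [hKeq, mul_sub, hHH, mul_assoc H b, ← mul_assoc H H, hHH]; simp
  have hHδH : H * δ * H = H := by
    rw [he, sub_mul, sub_mul, mul_assoc δ, hHH, mul_zero, one_mul, sub_zero, sub_eq_zero] at heH
    exact heH.symm
  have hHδK : H * δ * (Z * H) = Z * H := by
    calc H * δ * (Z * H) = H * δ * (H - H * b * (Z * H)) := by rw [← hKeq]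
      _ = H * δ * H - H * δ * H * b * (Z * H) := by noncomm_ring
      _ = Z * H := by rw [hHδH, ← hKeq]
  have hHDK : H * (δ + b) * (Z * H) = H := by
    rw [mul_add, add_mul, hHδK, hHbK]; abel
  have hebK : e * b * (Z * H) = 0 := by
    calc e * b * (Z * H) = e * b * (H - H * b * (Z * H)) := by rw [← hKeq]
      _ = e * b * H - e * b * H * b * (Z * H) := by noncomm_ring
      _ = 0 := by rw [hebH]; simp
  have hDK : (1 + H * b) * ((δ + b) * (Z * H)) = δ * H := by
    calc (1 + H * b) * ((δ + b) * (Z * H))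
        = (1 - δ * H - H * δ) * δ * (Z * H) + (1 - δ * H - H * δ) * b * (Z * H)
            + δ * (H * (δ + b) * (Z * H)) + H * ((δ + b) * (δ + b)) * (Z * H) := by
          noncomm_ring
      _ = δ * H := by
          rw [← he, heδ, hebK, hHDK, hw, hwH, mul_assoc w, hHK]; simp
  have hKD : (1 + H * b) * (Z * H * (δ + b)) = H * δ + H * b := by
    rw [← mul_assoc, hK, mul_add]
  have hmain : (1 + H * b) * (1 - Z * e) =
      (1 + H * b) * ((δ + b) * (Z * H) + Z * H * (δ + b)) := by
    rw [mul_add, hDK, hKD, mul_sub, ← mul_assoc, hZ, he]; noncomm_ring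
  calc 1 - Z * e = Z * ((1 + H * b) * (1 - Z * e)) := by rw [← mul_assoc, hZ', one_mul]
    _ = _ := by rw [hmain, ← mul_assoc, hZ', one_mul]

theorem geom_mul_one_add {x : E} {m : ℕ} (hx : x ^ m = 0) :
    (1 + x) * ∑ k ∈ Finset.range m, (-x) ^ k = 1 ∧
      (∑ k ∈ Finset.range m, (-x) ^ k) * (1 + x) = 1 := by
  have h1 := mul_neg_geom_sum (-x) m
  have h2 := geom_sum_mul_neg (-x) m
  rw [neg_pow, hx, mul_zero, sub_zero, sub_neg_eq_add] at h1 h2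
  exact ⟨h1, h2⟩

theorem mul_one_sub_homotopy {D K w : E} (hw : D * D = w) (hK : K * w = w * K) :
    D * (1 - (D * K + K * D)) = (1 - (D * K + K * D)) * D := by
  have h : D * (1 - (D * K + K * D)) - (1 - (D * K + K * D)) * D =
    K * (D * D) - D * D * K := by noncomm_ring
  rw [← sub_eq_zero, h, hw, hK, sub_self]

theorem mul_mul_of_anticomm {a b g : E} (ha : a * g = -(g * a)) (hb : b * g = -(g * b)) :
    a * b * g = g * (a * b) := by
  rw [mul_assoc, hb, mul_neg, ← mul_assoc, ha, neg_mul, neg_neg, mul_assoc]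

theorem mul_mul_of_comm_of_anticomm {a b g : E} (ha : a * g = g * a) (hb : b * g = -(g * b)) :
    a * b * g = -(g * (a * b)) := by
  rw [mul_assoc, hb, mul_neg, ← mul_assoc, ha, mul_assoc]

theorem proj_mul_of_anticomm {δ H g : E} (hδ : δ * g = -(g * δ)) (hH : H * g = -(g * H)) :
    (1 - δ * H - H * δ) * g = g * (1 - δ * H - H * δ) := by
  rw [sub_mul, sub_mul, mul_mul_of_anticomm hδ hH, mul_mul_of_anticomm hH hδ, mul_sub, mul_sub,
    one_mul, mul_one]

theorem add_mul_one_sub_mul {d a s b t : E} (hd : d * b = b * d + a) (ha : a * b = 0)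
    (hs : s * b = b * s) : (d + (a + s)) * ((1 - b) * t) = (1 - b) * ((d + s) * t) := by
  calc (d + (a + s)) * ((1 - b) * t) = (d + a + s - d * b - a * b - s * b) * t := by noncomm_ring
    _ = (d + a + s - (b * d + a) - 0 - b * s) * t := by rw [hd, ha, hs]
    _ = _ := by noncomm_ring

end RingIdentities

theorem map_list_prod_apply {A B : Type*} {M N : Type*} [Semiring A] [Semiring B]
    [AddCommMonoid M] [AddCommMonoid N] [Module A M] [Module B N] {κ F : Type*} [FunLike F M N]
    {π : F} {a : κ → Module.End A M} {b : κ → Module.End B N}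
    (h : ∀ j x, π (a j x) = b j (π x)) (l : List κ) (x : M) :
    π ((l.map a).prod x) = (l.map b).prod (π x) := by
  induction l with
  | nil => rfl
  | cons j l ih =>
    rw [List.map_cons, List.map_cons, List.prod_cons, List.prod_cons, Module.End.mul_apply,
      Module.End.mul_apply, h, ih]

section WedgePowers

variable {S : Type*} [CommRing S] {n : ℕ} {M : Type*} [AddCommGroup M] [Module S M]

theorem list_prod_ofFn_mul {E : Type*} [Monoid E] {m : ℕ} (a b : Fin m → E)
    (h : ∀ i j, Commute (b i) (a j)) :
    (List.ofFn fun i => a i * b i).prod = (List.ofFn a).prod * (List.ofFn b).prod := by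
  induction m with
  | zero => simp
  | succ m ih =>
    simp only [List.ofFn_succ, List.prod_cons]
    rw [ih _ _ fun i j => h _ _]
    have h1 : Commute (b 0) (List.ofFn fun i : Fin m => a i.succ).prod :=
      Commute.list_prod_right _ _ fun x hx => by
        obtain ⟨j, rfl⟩ := List.mem_ofFn.1 hx
        exact h _ _
    simp only [mul_assoc]
    rw [← mul_assoc (b 0), h1.eq, mul_assoc]

theorem list_prod_ofFn_diag {m : ℕ} (c : Fin m → Module.End S M) :
    (List.ofFn fun i => (diag (fun _ => c i) : Module.End S (Finset (Fin n) → M))).prod =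
      diag fun _ => (List.ofFn c).prod := by
  induction m with
  | zero => simp only [List.ofFn_zero, List.prod_nil]; rfl
  | succ m ih => simp only [List.ofFn_succ, List.prod_cons, ih, diag_mul_diag]

theorem list_prod_wedge_apply_single (x : M) (l : List (Fin n)) (hl : l.Pairwise (· < ·)) :
    (l.map (wedge S)).prod (Pi.single ∅ x) = Pi.single l.toFinset x := by
  induction l with
  | nil => simp
  | cons k l ih =>
    rw [List.pairwise_cons] at hl
    have hkl : k ∉ l.toFinset := fun h => lt_irrefl _ (hl.1 k (List.mem_toFinset.1 h))
    rw [List.map_cons, List.prod_cons, Module.End.mul_apply, ih hl.2, List.toFinset_cons]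
    funext I
    rw [wedge_apply]
    by_cases hI : I = insert k l.toFinset
    · subst hI
      have hs : ksign k l.toFinset = 1 := Finset.prod_eq_one fun i hi =>
        if_neg (hl.1 i (List.mem_toFinset.1 hi)).not_gt
      rw [if_pos (Finset.mem_insert_self _ _), ksign_insert_self, Finset.erase_insert hkl, hs,
        Pi.single_eq_same, Pi.single_eq_same, one_smul]
    · rw [Pi.single_eq_of_ne hI]
      split_ifs with hk
      · rw [Pi.single_eq_of_ne, smul_zero]
        rintro h
        exact hI (by rw [← h, Finset.insert_erase hk])
      · rfl

variable (S M n) in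
/-- The product of the exterior multiplications by `n` one-forms with constant coefficients. -/
def wedgeAlternating :
    (Fin n → ℤ) [⋀^Fin n]→ₗ[ℤ] Module.End S (Finset (Fin n) → M) :=
  (ExteriorAlgebra.lift ℤ ⟨Fintype.linearCombination ℤ (wedge S), fun v => by
    rw [Fintype.linearCombination_apply]
    refine sum_mul_sum_self_eq_zero _ _ (fun i => ?_) fun i j => ?_
    · rw [smul_mul_smul_comm, wedge_mul_self, smul_zero]
    · rw [smul_mul_smul_comm, smul_mul_smul_comm, wedge_mul_wedge, smul_neg,
        mul_comm (v i)]⟩).toLinearMap.compAlternatingMap (ExteriorAlgebra.ιMulti ℤ n)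

theorem wedgeAlternating_single (r : Fin n → Fin n) :
    wedgeAlternating S n M (fun i => Pi.single (r i) 1) =
      (List.ofFn fun i => wedge S (r i)).prod := by
  rw [wedgeAlternating, LinearMap.compAlternatingMap_apply, ExteriorAlgebra.ιMulti_apply,
    AlgHom.toLinearMap_apply, map_list_prod, List.map_ofFn]
  congr 2
  funext i
  simp only [Function.comp_apply, ExteriorAlgebra.lift_ι_apply]
  simp

/-- The top coefficient of the `n`-th power of the one-form `∑ⱼ dtⱼ cⱼ`. -/
theorem oneForm_pow_apply (c : Fin n → Module.End S M) (x : M) :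
    (oneForm c ^ n) (Pi.single ∅ x) Finset.univ =
      ∑ τ : Equiv.Perm (Fin n), (Equiv.Perm.sign τ : ℤ) •
        (List.ofFn fun k => c (τ k)).prod x := by
  have h1 : (oneForm c ^ n : Module.End S (Finset (Fin n) → M)) =
      ∑ r : Fin n → Fin n, wedgeAlternating S n M (fun i => Pi.single (r i) 1) *
        diag fun _ => (List.ofFn fun k => c (r k)).prod := by
    have h := MultilinearMap.map_sum
      (MultilinearMap.mkPiAlgebraFin S n (Module.End S (Finset (Fin n) → M)))
      (fun _ j => wedge S j * diag fun _ => c j)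
    simp only [MultilinearMap.mkPiAlgebraFin_apply, List.ofFn_const, List.prod_replicate] at h
    rw [oneForm, h]
    refine Finset.sum_congr rfl fun r _ => ?_
    rw [list_prod_ofFn_mul, wedgeAlternating_single, list_prod_ofFn_diag]
    exact fun i j => diag_mul_wedge _ _
  have h2 : ∀ y : M, (List.ofFn (wedge S)).prod (Pi.single ∅ y) =
      Pi.single (Finset.univ : Finset (Fin n)) y := fun y => by
    rw [List.ofFn_eq_map, list_prod_wedge_apply_single y _ (List.pairwise_lt_finRange n)]
    simp
  have h3 : ∀ (a : Module.End S M) (y : M),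
      (diag fun _ => a) (Pi.single ∅ y : Finset (Fin n) → M) = Pi.single ∅ (a y) :=
    fun a y => by
      funext I
      rw [diag_apply]
      exact (Pi.apply_single (fun _ => a) (fun _ => map_zero a) ∅ y I)
  rw [h1, LinearMap.sum_apply, Finset.sum_apply]
  refine (Finset.sum_of_injOn (fun τ : Equiv.Perm (Fin n) => (τ : Fin n → Fin n))
    (DFunLike.coe_injective.injOn) (by simp) (fun r _ hr => ?_) fun τ _ => ?_).symm
  · have hr' : ¬ Function.Injective fun i => (Pi.single (r i) 1 : Fin n → ℤ) := fun h => by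
      have hinj : Function.Injective r := fun i j hij => h (by simp [hij])
      exact hr ⟨Equiv.ofBijective r (Finite.injective_iff_bijective.1 hinj), by simp, rfl⟩
    rw [AlternatingMap.map_eq_zero_of_not_injective _ _ hr', zero_mul]
    rfl
  · have hperm := (wedgeAlternating S n M).map_perm (fun i => Pi.single i 1) τ
    have hid := wedgeAlternating_single (S := S) (M := M) (id : Fin n → Fin n)
    simp only [id] at hid
    simp only [Function.comp_def] at hperm
    rw [hperm, hid, Module.End.mul_apply, h3]
    rw [Units.smul_def, LinearMap.smul_apply, h2]
    simp

end WedgePowers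

/-- A matrix factorisation `(M, d)` with grading operator `g` over `S`, with null-homotopies
`lam` for commuting operators `u`, a flat connection `del` and its quotient `N = M/uM`. -/
structure PushforwardData (S M N : Type*) [CommRing S] [AddCommGroup M] [Module S M]
    [AddCommGroup N] [Module S N] (n : ℕ) where
  W : S
  d : Module.End S M
  g : Module.End S M
  u : Fin n → Module.End S M
  del : Fin n → Module.End S M
  lam : Fin n → Module.End S M
  inv : ℕ → Module.End S M
  π : M →ₗ[S] N
  dQ : Module.End S N
  gQ : Module.End S N
  comQ : Fin n → Module.End S N
  d_d : d * d = W • 1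
  d_g : d * g = -(g * d)
  lam_g : ∀ j, lam j * g = -(g * lam j)
  lam_d : ∀ j, lam j * d + d * lam j = u j
  u_u : ∀ i j, u i * u j = u j * u i
  u_d : ∀ i, u i * d = d * u i
  u_g : ∀ i, u i * g = g * u i
  u_lam : ∀ i j, u i * lam j = lam j * u i
  del_g : ∀ j, del j * g = g * del j
  del_u : ∀ j i, del j * u i = u i * del j + if i = j then 1 else 0
  del_del : ∀ i j, del i * del j = del j * del i
  inv_mul : ∀ k, 0 < k → inv k * (k + ∑ i, u i * del i) = 1
  mul_inv : ∀ k, 0 < k → (k + ∑ i, u i * del i) * inv k = 1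
  π_surj : Function.Surjective π
  π_u : ∀ i x, π (u i x) = 0
  ker_π : ∀ x, π x = 0 → ∃ y : Fin n → M, x = ∑ i, u i (y i)
  π_d : ∀ x, π (d x) = dQ (π x)
  π_g : ∀ x, π (g x) = gQ (π x)
  π_com : ∀ j x, π (del j (d x) - d (del j x)) = comQ j (π x)

namespace PushforwardData

variable {S M N : Type*} [CommRing S] [AddCommGroup M] [Module S M]
    [AddCommGroup N] [Module S N] {n : ℕ} (X : PushforwardData S M N n)

/-- The Koszul differential on `M`-valued forms. -/
def δ : Module.End S (Finset (Fin n) → M) := ∑ i, diag (fun _ => X.u i) * contr S i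

/-- The flat connection on `M`-valued forms. -/
def nab : Module.End S (Finset (Fin n) → M) :=
  oneForm X.del

/-- The differential of `M` on `M`-valued forms, with Koszul signs. -/
def dF : Module.End S (Finset (Fin n) → M) := diag fun k => (-1) ^ k * X.d

/-- The grading operator on `M`-valued forms. -/
def gF : Module.End S (Finset (Fin n) → M) := diag fun k => (-1) ^ k * X.g

/-- The projection onto the forms of degree zero. -/
def p : Module.End S (Finset (Fin n) → M) := diag fun k => if k = 0 then 1 else 0

/-- The inverse of `δ∇ + ∇δ` in positive degrees. -/
def G : Module.End S (Finset (Fin n) → M) := diag fun k => if k = 0 then 0 else X.inv k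

theorem δ_δ : X.δ * X.δ = 0 := by
  have h : ∀ i j, (diag (fun _ => X.u i) * contr S i * (diag (fun _ => X.u j) * contr S j) :
      Module.End S (Finset (Fin n) → M)) =
        diag (fun _ => X.u i * X.u j) * (contr S i * contr S j) := fun i j => by
    rw [mul_assoc, ← mul_assoc (contr S i), contr_mul_diag, ← diag_mul_diag]
    simp only [mul_assoc]
  refine sum_mul_sum_self_eq_zero _ _ (fun i => ?_) fun i j => ?_
  · rw [h, contr_mul_self, mul_zero]
  · rw [h, h, X.u_u, contr_mul_contr]
    exact LinearMap.comp_neg _ _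

theorem nab_nab : X.nab * X.nab = 0 := by
  have h : ∀ i j, (wedge S i * diag (fun _ => X.del i) * (wedge S j * diag (fun _ => X.del j)) :
      Module.End S (Finset (Fin n) → M)) =
        wedge S i * wedge S j * diag (fun _ => X.del i * X.del j) := fun i j => by
    rw [mul_assoc, ← mul_assoc (diag _), diag_mul_wedge, ← diag_mul_diag]
    simp only [mul_assoc]
  rw [nab, oneForm]
  refine sum_mul_sum_self_eq_zero _ _ (fun i => ?_) fun i j => ?_
  · rw [h, wedge_mul_self, zero_mul]
  · rw [h, h, X.del_del, wedge_mul_wedge]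
    exact LinearMap.neg_comp _ _

theorem lap_eq : X.nab * X.δ + X.δ * X.nab =
    diag fun k => (k + ∑ i, X.u i * X.del i : Module.End S M) := by
  have h : ∀ i j : Fin n,
      (wedge S j * diag (fun _ => X.del j) * (diag (fun _ => X.u i) * contr S i) +
      diag (fun _ => X.u i) * contr S i * (wedge S j * diag (fun _ => X.del j)) :
      Module.End S (Finset (Fin n) → M)) =
        if i = j then wedge S i * contr S i + diag (fun _ => X.u i * X.del i) else 0 :=
      fun i j => by
    have h1 : (wedge S j * diag (fun _ => X.del j) * (diag (fun _ => X.u i) * contr S i) :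
        Module.End S (Finset (Fin n) → M)) =
        wedge S j * diag (fun _ => X.u i * X.del j) * contr S i +
          if i = j then wedge S j * contr S i else 0 := by
      rw [mul_assoc, ← mul_assoc (diag _), diag_mul_diag]
      simp only [X.del_u]
      split_ifs
      · rw [mul_assoc, ← mul_add]; congr 1
      · simp only [add_zero, mul_assoc]
    have h2 : (diag (fun _ => X.u i) * contr S i * (wedge S j * diag (fun _ => X.del j)) :
        Module.End S (Finset (Fin n) → M)) =
        (if i = j then diag (fun _ => X.u i * X.del j) else 0) -
          wedge S j * diag (fun _ => X.u i * X.del j) * contr S i := by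
      rw [mul_assoc, ← mul_assoc (contr S i), contr_mul_wedge, sub_mul, mul_sub,
        mul_assoc (wedge S j), contr_mul_diag, ← mul_assoc _ (wedge S j), diag_mul_wedge,
        mul_assoc (wedge S j), mul_assoc (wedge S j), ← mul_assoc (diag _) (diag _),
        diag_mul_diag]
      split_ifs
      · rw [one_mul, diag_mul_diag]
      · simp
    rw [h1, h2]
    split_ifs with hij
    · subst hij; abel
    · abel
  have hsum : X.nab * X.δ + X.δ * X.nab = ∑ i : Fin n, ∑ j : Fin n,
      if i = j then (wedge S i * contr S i + diag (fun _ => X.u i * X.del i) :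
      Module.End S (Finset (Fin n) → M)) else 0 := by
    simp only [← h, Finset.sum_add_distrib, nab, oneForm, δ, Finset.sum_mul_sum]
    rw [Finset.sum_comm]
  rw [hsum]
  simp only [Finset.sum_ite_eq, Finset.mem_univ, if_true, Finset.sum_add_distrib]
  rw [sum_wedge_mul_contr]
  refine LinearMap.ext fun f => funext fun I => ?_
  simp [diag_apply, LinearMap.sum_apply]

theorem isContraction : IsContraction X.δ X.nab X.G p where
  δ_δ := X.δ_δ
  nab_nab := X.nab_nab
  G_lap := by
    rw [lap_eq, G, diag_mul_diag]
    refine LinearMap.ext fun f => funext fun I => ?_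
    rcases Nat.eq_zero_or_pos I.card with h | h
    · simp [diag_apply, h, p]
    · simp only [diag_apply, h.ne', if_false, X.inv_mul _ h, p, LinearMap.sub_apply, Pi.sub_apply]
      simp
  lap_G := by
    rw [lap_eq, G, diag_mul_diag]
    refine LinearMap.ext fun f => funext fun I => ?_
    rcases Nat.eq_zero_or_pos I.card with h | h
    · simp [diag_apply, h, p]
    · simp only [diag_apply, h.ne', if_false, X.mul_inv _ h, p, LinearMap.sub_apply, Pi.sub_apply]
      simp
  p_nab := by
    rw [nab, oneForm, Finset.mul_sum]
    refine Finset.sum_eq_zero fun j _ => ?_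
    rw [p, ← mul_assoc, diag_mul_wedge]
    refine LinearMap.ext fun f => funext fun I => ?_
    simp [wedge_apply, diag_apply]
  δ_p := by
    rw [δ, Finset.sum_mul]
    refine Finset.sum_eq_zero fun j _ => ?_
    rw [p, mul_assoc, contr_mul_diag]
    refine LinearMap.ext fun f => funext fun I => ?_
    simp [diag_apply]
  p_G := by
    refine LinearMap.ext fun f => funext fun I => ?_
    simp only [p, G, Module.End.mul_apply, diag_apply]
    split_ifs <;> rfl
  G_p := by
    refine LinearMap.ext fun f => funext fun I => ?_
    simp only [p, G, Module.End.mul_apply, diag_apply]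
    split_ifs <;> simp

theorem δ_mul_diag {a : Module.End S M} (h : ∀ i, X.u i * a = a * X.u i) :
    X.δ * diag (fun k => (-1) ^ k * a) = -(diag (fun k => (-1) ^ k * a) * X.δ) := by
  rw [δ, Finset.sum_mul, Finset.mul_sum, ← Finset.sum_neg_distrib]
  refine Finset.sum_congr rfl fun i _ => ?_
  rw [mul_assoc, contr_mul_diag, ← mul_assoc, ← mul_assoc, diag_mul_diag, diag_mul_diag]
  have : (fun k => X.u i * ((-1) ^ (k + 1) * a)) = fun k => -((-1) ^ k * a * X.u i) := by
    funext k
    rcases neg_one_pow_eq_or (Module.End S M) k with hk | hk <;> simp [pow_succ, hk, h]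
  rw [this]
  refine LinearMap.ext fun f => funext fun I => ?_
  simp [diag_apply]

theorem nab_mul_diag {a : Module.End S M} (h : ∀ i, X.del i * a = a * X.del i) :
    X.nab * diag (fun k => (-1) ^ k * a) = -(diag (fun k => (-1) ^ k * a) * X.nab) := by
  rw [nab, oneForm, Finset.sum_mul, Finset.mul_sum, ← Finset.sum_neg_distrib]
  refine Finset.sum_congr rfl fun i _ => ?_
  rw [mul_assoc, ← mul_assoc (diag _) (wedge S i), diag_mul_wedge, mul_assoc (wedge S i),
    diag_mul_diag, diag_mul_diag]
  have : (fun k => (-1) ^ (k + 1) * a * X.del i) = fun k => -(X.del i * ((-1) ^ k * a)) := by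
    funext k
    rcases neg_one_pow_eq_or (Module.End S M) k with hk | hk <;> simp [pow_succ, hk, h]
  rw [this]
  refine LinearMap.ext fun f => funext fun I => ?_
  simp only [Module.End.mul_apply, LinearMap.neg_apply, Pi.neg_apply, diag_apply, wedge_apply]
  split_ifs <;> simp

theorem dF_dF : X.dF * X.dF = X.W • 1 := by
  refine LinearMap.ext fun f => funext fun I => ?_
  have h := fun x => LinearMap.congr_fun X.d_d x
  simp only [Module.End.mul_apply] at h
  rcases neg_one_pow_eq_or (Module.End S M) I.card with hk | hk <;>
    simp [dF, diag_apply, hk, h]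

theorem D_D : (X.δ + X.dF) * (X.δ + X.dF) = X.W • 1 := by
  rw [add_mul, mul_add, mul_add, X.δ_δ, X.dF_dF, dF, X.δ_mul_diag X.u_d]
  abel

theorem dF_gF : X.dF * X.gF = -(X.gF * X.dF) := by
  refine LinearMap.ext fun f => funext fun I => ?_
  have h := fun x => LinearMap.congr_fun X.d_g x
  simp only [Module.End.mul_apply] at h
  rcases neg_one_pow_eq_or (Module.End S M) I.card with hk | hk <;>
    simp [dF, gF, diag_apply, hk, h]

theorem inv_g (k : ℕ) (hk : 0 < k) : X.inv k * X.g = X.g * X.inv k := by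
  have h1 : (k + ∑ i, X.u i * X.del i) * X.g = X.g * (k + ∑ i, X.u i * X.del i) := by
    rw [add_mul, mul_add, Finset.sum_mul, Finset.mul_sum, (Nat.cast_commute k X.g).eq]
    congr 1
    refine Finset.sum_congr rfl fun i _ => ?_
    rw [mul_assoc, X.del_g, ← mul_assoc, X.u_g, mul_assoc]
  calc X.inv k * X.g = X.inv k * (X.g * (k + ∑ i, X.u i * X.del i)) * X.inv k := by
        rw [mul_assoc, mul_assoc, X.mul_inv k hk, mul_one]
    _ = X.g * X.inv k := by
        rw [← h1, ← mul_assoc, X.inv_mul k hk, one_mul]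

theorem G_gF : X.G * X.gF = X.gF * X.G := by
  rw [G, gF, diag_mul_diag, diag_mul_diag]
  congr 1; funext k
  split_ifs with hk
  · simp
  · have := X.inv_g k (Nat.pos_of_ne_zero hk)
    rcases neg_one_pow_eq_or (Module.End S M) k with hk | hk <;> simp [hk, this]

/-- The contracting homotopy of the Koszul complex defined by the connection. -/
def H : Module.End S (Finset (Fin n) → M) := X.G * X.nab

/-- The projection of the Koszul complex onto the horizontal sections in degree zero. -/
def e : Module.End S (Finset (Fin n) → M) := 1 - X.δ * X.H - X.H * X.δ

theorem H_gF : X.H * X.gF = -(X.gF * X.H) :=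
  mul_mul_of_comm_of_anticomm X.G_gF (X.nab_mul_diag X.del_g)

theorem δ_gF : X.δ * X.gF = -(X.gF * X.δ) := X.δ_mul_diag X.u_g

theorem e_gF : X.e * X.gF = X.gF * X.e :=
  proj_mul_of_anticomm X.δ_gF X.H_gF

theorem e_p : X.e * p = X.e := X.isContraction.proj_p

/-- The perturbing operator; it raises the degree of forms by one. -/
def F : Module.End S (Finset (Fin n) → M) := X.H * X.dF

theorem F_gF : X.F * X.gF = X.gF * X.F := mul_mul_of_anticomm X.H_gF X.dF_gF

theorem F_apply_eq_zero {f : Finset (Fin n) → M} {I : Finset (Fin n)}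
    (h : ∀ j ∈ I, f (I.erase j) = 0) : X.F f I = 0 := by
  have h1 : X.nab (X.dF f) I = 0 := by
    rw [nab, oneForm_apply]
    refine Finset.sum_eq_zero fun j _ => ?_
    simp only [diag_apply, dF]
    split_ifs with hj
    · simp [h j hj]
    · rfl
  simp only [F, H, G, Module.End.mul_apply, diag_apply]
  rw [h1, map_zero]

theorem F_pow_apply_eq_zero (m : ℕ) (f : Finset (Fin n) → M) (I : Finset (Fin n))
    (hI : I.card < m) : ((-X.F) ^ m) f I = 0 := by
  induction m generalizing I with
  | zero => omega
  | succ m ih =>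
    rw [pow_succ', Module.End.mul_apply, LinearMap.neg_apply, Pi.neg_apply,
      X.F_apply_eq_zero, neg_zero]
    intro j hj
    exact ih _ (by have := Finset.card_erase_add_one hj; omega)

theorem F_pow_single_eq_zero (m : ℕ) (x : M) (I : Finset (Fin n))
    (hI : I.card ≠ m) : ((-X.F) ^ m) (Pi.single ∅ x) I = 0 := by
  induction m generalizing I with
  | zero =>
    have : I ≠ ∅ := fun h => hI (by simp [h])
    simp [this]
  | succ m ih =>
    rw [pow_succ', Module.End.mul_apply, LinearMap.neg_apply, Pi.neg_apply,
      X.F_apply_eq_zero, neg_zero]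
    intro j hj
    exact ih _ (by have := Finset.card_erase_add_one hj; omega)

theorem F_pow_eq_zero : X.F ^ (n + 1) = 0 := by
  have h : (-X.F) ^ (n + 1) = 0 := by
    refine LinearMap.ext fun f => funext fun I => ?_
    exact X.F_pow_apply_eq_zero _ f I
      (by have := I.card_le_univ; rw [Fintype.card_fin] at this; omega)
  rcases neg_one_pow_eq_or (Module.End S (Finset (Fin n) → M)) (n + 1) with hk | hk <;>
    simpa [neg_pow X.F, hk] using h

/-- The inverse of `1 + F`. -/
def Z : Module.End S (Finset (Fin n) → M) := ∑ k ∈ Finset.range (n + 1), (-X.F) ^ k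

theorem Z_gF : X.Z * X.gF = X.gF * X.Z := by
  have h : Commute X.gF X.F := X.F_gF.symm
  exact (Commute.sum_right _ _ _ fun k _ => (h.neg_right).pow_right k).eq.symm

theorem Z_single_univ (x : M) :
    X.Z (Pi.single ∅ x) Finset.univ = ((-X.F) ^ n) (Pi.single ∅ x) Finset.univ := by
  rw [Z, LinearMap.sum_apply, Finset.sum_apply]
  refine Finset.sum_eq_single n (fun m _ hm => ?_) fun h => by simp at h
  exact X.F_pow_single_eq_zero m x _ (by simpa using hm.symm)

theorem e_dF_H : X.e * X.dF * X.H = 0 := by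
  have h1 : (p : Module.End S (Finset (Fin n) → M)) * X.dF = X.dF * p := by
    rw [p, dF, diag_mul_diag, diag_mul_diag]
    congr 1; funext k; split_ifs <;> simp
  rw [← X.e_p, mul_assoc X.e, h1, H, mul_assoc, mul_assoc, ← mul_assoc p, X.isContraction.p_G]
  simp

theorem one_sub_Z_e :
    1 - X.Z * X.e = (X.δ + X.dF) * (X.Z * X.H) + X.Z * X.H * (X.δ + X.dF) := by
  have hZ := geom_mul_one_add X.F_pow_eq_zero
  exact perturbation rfl X.isContraction.H_H X.isContraction.proj_H X.isContraction.proj_δ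
    X.e_dF_H hZ.1 hZ.2 X.D_D (by rw [smul_one_mul, mul_smul_one])

theorem D_Z_e : (X.δ + X.dF) * (X.Z * X.e) = X.Z * X.e * (X.δ + X.dF) := by
  have h := X.one_sub_Z_e
  have h1 : X.Z * X.e = 1 - ((X.δ + X.dF) * (X.Z * X.H) + X.Z * X.H * (X.δ + X.dF)) := by
    rw [← h]; abel
  rw [h1]
  exact mul_one_sub_homotopy X.D_D (by rw [smul_one_mul, mul_smul_one])

/-- The part of the twisting automorphism contributed by `λⱼ`. -/
def B (j : Fin n) : Module.End S (Finset (Fin n) → M) :=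
  diag (fun k => (-1) ^ k * X.lam j) * contr S j

/-- The automorphism untwisting the Koszul complex of `M` with respect to the `uⱼ`, `j ∈ l`. -/
def T (l : List (Fin n)) : Module.End S (Finset (Fin n) → M) := (l.map fun j => 1 - X.B j).prod

theorem B_gF (j : Fin n) : X.B j * X.gF = X.gF * X.B j := by
  rw [B, gF, mul_assoc, contr_mul_diag, ← mul_assoc, ← mul_assoc, diag_mul_diag, diag_mul_diag]
  congr 2; funext k
  have h := X.lam_g j
  rcases neg_one_pow_eq_or (Module.End S M) k with hk | hk <;> simp [pow_succ, hk, h]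

theorem T_gF (l : List (Fin n)) : X.T l * X.gF = X.gF * X.T l := by
  refine (Commute.list_prod_left (l.map fun j => 1 - X.B j) X.gF fun x hx => ?_).eq
  obtain ⟨j, -, rfl⟩ := List.mem_map.1 hx
  exact (Commute.one_left _).sub_left (X.B_gF j)

theorem dF_B (j : Fin n) :
    X.dF * X.B j = X.B j * X.dF + diag (fun _ => X.u j) * contr S j := by
  rw [B, dF, mul_assoc _ (contr S j), contr_mul_diag, ← mul_assoc, ← mul_assoc, diag_mul_diag,
    diag_mul_diag, ← add_mul]
  congr 1
  refine LinearMap.ext fun f => funext fun I => ?_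
  have h := X.lam_d j
  rcases neg_one_pow_eq_or (Module.End S M) I.card with hk | hk <;>
    simp [diag_apply, pow_succ, hk, ← h]

theorem u_contr_B (i j : Fin n) :
    diag (fun _ => X.u i) * contr S i * X.B j = X.B j * (diag (fun _ => X.u i) * contr S i) := by
  have h1 : diag (fun _ => X.u i) * contr S i * X.B j =
      diag (fun k => X.u i * ((-1) ^ (k + 1) * X.lam j)) * (contr S i * contr S j) := by
    rw [B, mul_assoc, ← mul_assoc (contr S i), contr_mul_diag, mul_assoc (diag _),
      ← mul_assoc (diag _), diag_mul_diag]
  have h2 : X.B j * (diag (fun _ => X.u i) * contr S i) =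
      diag (fun k => (-1) ^ k * X.lam j * X.u i) * (contr S j * contr S i) := by
    rw [B, mul_assoc, ← mul_assoc (contr S j), contr_mul_diag, mul_assoc (diag _),
      ← mul_assoc (diag _), diag_mul_diag]
  have h3 : (fun k => X.u i * ((-1) ^ (k + 1) * X.lam j)) =
      fun k => -((-1) ^ k * X.lam j * X.u i) := by
    funext k
    rcases neg_one_pow_eq_or (Module.End S M) k with hk | hk <;>
      simp [pow_succ, hk, X.u_lam]
  rw [h1, h2, h3, contr_mul_contr]
  refine LinearMap.ext fun f => funext fun I => ?_
  simp [diag_apply]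

theorem u_contr_B_self (j : Fin n) : diag (fun _ => X.u j) * contr S j * X.B j = 0 := by
  rw [B, mul_assoc, ← mul_assoc (contr S j), contr_mul_diag, mul_assoc _ (contr S j),
    contr_mul_self]
  simp

theorem D_T_list (l : List (Fin n)) :
    (X.dF + (l.map fun j => diag (fun _ => X.u j) * contr S j).sum) * X.T l = X.T l * X.dF := by
  induction l with
  | nil => simp [T]
  | cons j l ih =>
    have hT : X.T (j :: l) = (1 - X.B j) * X.T l := by simp [T]
    have hs : (l.map fun j => diag (fun _ => X.u j) * contr S j).sum * X.B j =
        X.B j * (l.map fun j => diag (fun _ => X.u j) * contr S j).sum := by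
      refine (Commute.list_sum_left _ _ fun x hx => ?_).eq
      obtain ⟨i, -, rfl⟩ := List.mem_map.1 hx
      exact X.u_contr_B i j
    rw [List.map_cons, List.sum_cons, hT, mul_assoc _ _ X.dF, ← ih]
    exact add_mul_one_sub_mul (X.dF_B j) (X.u_contr_B_self j) hs

/-- The untwisting automorphism of the Koszul complex of `M`. -/
abbrev TF : Module.End S (Finset (Fin n) → M) := X.T (List.finRange n)

theorem D_TF : (X.δ + X.dF) * X.TF = X.TF * X.dF := by
  rw [← X.D_T_list, add_comm, δ, ← List.ofFn_eq_map, List.sum_ofFn]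

theorem T_apply_univ (l : List (Fin n)) (f : Finset (Fin n) → M) :
    X.T l f Finset.univ = f Finset.univ := by
  induction l with
  | nil => simp [T]
  | cons j l ih =>
    have hT : X.T (j :: l) = (1 - X.B j) * X.T l := by simp [T]
    rw [hT, Module.End.mul_apply, LinearMap.sub_apply, Pi.sub_apply, Module.End.one_apply, ih]
    simp [B, diag_apply, contr_apply]

theorem T_single_univ (x : M) (l : List (Fin n)) (hl : l.Pairwise (· < ·))
    (hl' : ∀ i, i ∉ l → ∀ j ∈ l, i < j) :
    (∀ I : Finset (Fin n), (∃ i, i ∉ l ∧ i ∉ I) →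
      X.T l (Pi.single Finset.univ x) I = 0) ∧
    X.T l (Pi.single Finset.univ x) l.toFinsetᶜ =
      (-1 : ℤ) ^ l.length • (l.map X.lam).prod x := by
  induction l with
  | nil =>
    constructor
    · rintro I ⟨i, -, hi⟩
      have : I ≠ Finset.univ := fun h => hi (h ▸ Finset.mem_univ i)
      simp [T, this]
    · simp [T]
  | cons k l ih =>
    rw [List.pairwise_cons] at hl
    obtain ⟨ih1, ih2⟩ := ih hl.2 fun i hi j hj => by
      by_cases hik : i = k
      · exact hik ▸ hl.1 j hj
      · exact hl' i (by simp [hik, hi]) j (by simp [hj])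
    have hkl : k ∉ l := fun h => lt_irrefl _ (hl.1 k h)
    have hT : X.T (k :: l) = (1 - X.B k) * X.T l := by simp [T]
    have hstep : ∀ I, X.T (k :: l) (Pi.single Finset.univ x) I =
        X.T l (Pi.single Finset.univ x) I - ((-1) ^ I.card * X.lam k : Module.End S M)
          (if k ∈ I then 0 else ksign k I • X.T l (Pi.single Finset.univ x) (insert k I)) :=
      fun I => by
        rw [hT, Module.End.mul_apply, LinearMap.sub_apply, Pi.sub_apply]
        rfl
    constructor
    · rintro I ⟨i, hi, hiI⟩
      simp only [List.mem_cons, not_or] at hi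
      rw [hstep, ih1 I ⟨i, hi.2, hiI⟩, ih1 (insert k I) ⟨i, hi.2, by simp [hi.1, hiI]⟩]
      simp
    · have hI : insert k (k :: l).toFinsetᶜ = l.toFinsetᶜ := by
        ext i
        simp only [Finset.mem_insert, Finset.mem_compl, List.toFinset_cons, List.mem_toFinset]
        by_cases hik : i = k
        · simp [hik, hkl]
        · simp [hik]
      have hsgn : ksign k (k :: l).toFinsetᶜ = (-1) ^ ((k :: l).toFinsetᶜ).card := by
        rw [ksign, Finset.prod_congr rfl (g := fun _ => (-1 : ℤ)), Finset.prod_const]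
        intro i hi
        rw [Finset.mem_compl, List.mem_toFinset] at hi
        rw [if_pos (hl' i hi k (by simp))]
      rw [hstep, hI, ih2, ih1 _ ⟨k, hkl, by simp⟩, if_neg (by simp), hsgn]
      generalize ((k :: l).toFinsetᶜ).card = m
      rw [zero_sub, List.length_cons, List.map_cons, List.prod_cons, pow_succ]
      rcases Nat.even_or_odd m with hm | hm <;>
        simp [hm.neg_one_pow]

theorem TF_single_univ (x : M) :
    X.TF (Pi.single Finset.univ x) ∅ = (-1 : ℤ) ^ n • (List.ofFn X.lam).prod x := by
  have h := (X.T_single_univ x (List.finRange n) (List.pairwise_lt_finRange n)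
    fun i hi => absurd (List.mem_finRange i) hi).2
  rw [List.length_finRange, ← List.ofFn_eq_map] at h
  rw [← h]
  simp

theorem neg_one_pow_mul_apply (k : ℕ) (a : Module.End S M) (x : M) :
    ((-1) ^ k * a : Module.End S M) x = (-1 : ℤ) ^ k • a x := by
  rcases Nat.even_or_odd k with h | h <;> simp [h.neg_one_pow]

theorem π_nab_dF_apply {f : Finset (Fin n) → M} (hf : X.nab f = 0) (I : Finset (Fin n)) :
    X.π (X.nab (X.dF f) I) = (-1 : ℤ) ^ (I.card + 1) •
      oneForm X.comQ (fun J => X.π (f J)) I := by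
  have h0 : (-1 : ℤ) ^ (I.card + 1) • X.d (X.nab f I) = 0 := by rw [hf]; simp
  have h1 : X.nab (X.dF f) I = (-1 : ℤ) ^ (I.card + 1) • ∑ j, if j ∈ I then
      ksign j I • (X.del j (X.d (f (I.erase j))) - X.d (X.del j (f (I.erase j)))) else 0 := by
    refine ((sub_zero _).symm.trans (congrArg _ h0.symm)).trans ?_
    rw [nab, oneForm_apply, oneForm_apply, map_sum]
    simp only [Finset.smul_sum]
    rw [← Finset.sum_sub_distrib]
    refine Finset.sum_congr rfl fun j _ => ?_
    split_ifs with hj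
    · rw [dF, diag_apply, neg_one_pow_mul_apply, ← Finset.card_erase_add_one hj]
      generalize (I.erase j).card = m
      rcases Nat.even_or_odd m with hm | hm <;>
        simp [pow_succ, hm.neg_one_pow, smul_sub]
    · simp
  rw [h1, map_zsmul, map_sum, oneForm_apply]
  congr 1
  refine Finset.sum_congr rfl fun j _ => ?_
  split_ifs with hj
  · rw [map_zsmul, X.π_com]
  · simp

theorem π_F_apply {f : Finset (Fin n) → M} (hf : X.nab f = 0) (I : Finset (Fin n))
    (hI : 0 < I.card) :
    (I.card : ℤ) • X.π (X.F f I) = (-1 : ℤ) ^ (I.card + 1) •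
      oneForm X.comQ (fun J => X.π (f J)) I := by
  rw [← X.π_nab_dF_apply hf]
  have h := LinearMap.congr_fun (X.mul_inv I.card hI) (X.nab (X.dF f) I)
  have hF : X.F f I = X.inv I.card (X.nab (X.dF f) I) := by
    simp only [F, H, G, Module.End.mul_apply, diag_apply, if_neg hI.ne']
  rw [Module.End.mul_apply, ← hF, LinearMap.add_apply, LinearMap.sum_apply,
    Module.End.one_apply] at h
  rw [← h, map_add, map_sum]
  simp [X.π_u]

theorem nab_F : X.nab * X.F = 0 := by
  rw [F, H, ← mul_assoc, ← mul_assoc, X.isContraction.nab_G_nab, zero_mul]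

theorem π_F_pow_single {x : M} (hx : X.nab (Pi.single ∅ x) = 0) (m : ℕ)
    (I : Finset (Fin n)) (hI : I.card = m) :
    (m.factorial : ℤ) • X.π (((-X.F) ^ m) (Pi.single ∅ x) I) = (-1 : ℤ) ^ (m * (m + 1) / 2) •
      (oneForm X.comQ ^ m) (Pi.single ∅ (X.π x)) I := by
  induction m generalizing I with
  | zero =>
    rw [Finset.card_eq_zero] at hI
    subst hI; simp
  | succ m ih =>
    set y := ((-X.F) ^ m) (Pi.single ∅ x) with hy
    have hny : X.nab y = 0 := by
      cases m with
      | zero => simpa [hy] using hx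
      | succ m =>
        rw [hy, pow_succ', Module.End.mul_apply, LinearMap.neg_apply, map_neg,
          ← Module.End.mul_apply, X.nab_F]; simp
    have hF := X.π_F_apply hny I (by omega)
    rw [hI] at hF
    have hexp : (m + 1) * (m + 1 + 1) / 2 = m * (m + 1) / 2 + (m + 1) := by
      rw [show (m + 1) * (m + 1 + 1) = m * (m + 1) + (m + 1) * 2 by ring,
        Nat.add_mul_div_right _ _ (by norm_num)]
    have key : (m.factorial : ℤ) •
        oneForm X.comQ (fun J => X.π (y J)) I =
        (-1 : ℤ) ^ (m * (m + 1) / 2) • (oneForm X.comQ ^ (m + 1))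
          (Pi.single ∅ (X.π x)) I := by
      rw [pow_succ', Module.End.mul_apply, oneForm_apply, oneForm_apply, Finset.smul_sum,
        Finset.smul_sum]
      refine Finset.sum_congr rfl fun j _ => ?_
      split_ifs with hj
      · rw [smul_comm, ← map_zsmul, ih (I.erase j) (by rw [Finset.card_erase_of_mem hj]; omega),
          map_zsmul, smul_comm]
      · rw [smul_zero, smul_zero]
    rw [pow_succ', Module.End.mul_apply, LinearMap.neg_apply, ← hy, Pi.neg_apply, map_neg,
      hexp, pow_add, mul_comm ((-1 : ℤ) ^ _), mul_smul, ← key, Nat.factorial_succ,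
      mul_comm (m + 1), Nat.cast_mul, mul_smul, smul_neg, hF, smul_neg,
      smul_comm (m.factorial : ℤ), pow_succ _ (m + 1)]
    simp

theorem p_apply (f : Finset (Fin n) → M) :
    (p : Module.End S (Finset (Fin n) → M)) f = Pi.single ∅ (f ∅) := by
  funext I
  rcases eq_or_ne I ∅ with rfl | hI
  · simp [p, diag_apply]
  · simp [p, diag_apply, hI]

theorem δ_single (x : M) : X.δ (Pi.single ∅ x) = 0 := by
  have h := LinearMap.congr_fun X.isContraction.δ_p (Pi.single ∅ x)
  rwa [Module.End.mul_apply, p_apply, Pi.single_eq_same,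
    LinearMap.zero_apply] at h

theorem π_δ_apply (f : Finset (Fin n) → M) (I : Finset (Fin n)) : X.π (X.δ f I) = 0 := by
  rw [δ, LinearMap.sum_apply, Finset.sum_apply, map_sum]
  exact Finset.sum_eq_zero fun i _ => X.π_u i _

theorem δ_apply_univ (f : Finset (Fin n) → M) : X.δ f Finset.univ = 0 := by
  rw [δ, LinearMap.sum_apply, Finset.sum_apply]
  exact Finset.sum_eq_zero fun i _ => by simp [diag_apply, contr_apply]

theorem δ_sum_wedge (y : Fin n → M) :
    X.δ (∑ j, wedge S j (Pi.single ∅ (y j))) = Pi.single ∅ (∑ j, X.u j (y j)) := by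
  have h : ∀ i j, contr S i (wedge S j (Pi.single ∅ (y j))) =
      if i = j then (Pi.single ∅ (y j) : Finset (Fin n) → M) else 0 := fun i j => by
    have h0 : contr S i (Pi.single ∅ (y j) : Finset (Fin n) → M) = 0 := by
      funext I
      rw [contr_apply]
      split_ifs <;> simp
    rw [← Module.End.mul_apply, contr_mul_wedge, LinearMap.sub_apply, Module.End.mul_apply, h0,
      map_zero, sub_zero]
    split_ifs <;> rfl
  have h1 : ∀ i, contr S i (∑ j, wedge S j (Pi.single ∅ (y j))) =
      (Pi.single ∅ (y i) : Finset (Fin n) → M) := fun i => by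
    simp [map_sum, h]
  rw [δ, LinearMap.sum_apply]
  simp only [Module.End.mul_apply, h1]
  funext I
  rw [Finset.sum_apply]
  rcases eq_or_ne I ∅ with rfl | hI <;> simp [diag_apply, *]

/-- The projection of `M` onto its horizontal sections. -/
def horiz : M →ₗ[S] M := LinearMap.proj ∅ ∘ₗ X.e ∘ₗ LinearMap.single S (fun _ => M) ∅

theorem e_apply (f : Finset (Fin n) → M) : X.e f = Pi.single ∅ (X.horiz (f ∅)) := by
  have h1 : p * X.e = X.e := by
    have h := X.isContraction.proj_eq
    have hp : (p * p : Module.End S (Finset (Fin n) → M)) = p :=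
      LinearMap.ext fun f => by simp [p_apply]
    change p * (1 - X.δ * (X.G * X.nab) - X.G * X.nab * X.δ) =
      1 - X.δ * (X.G * X.nab) - X.G * X.nab * X.δ
    rw [h, ← mul_assoc, hp]
  conv_lhs => rw [← h1, ← X.e_p, Module.End.mul_apply, Module.End.mul_apply, p_apply, p_apply]
  rfl

theorem nab_single_horiz (x : M) : X.nab (Pi.single ∅ (X.horiz x)) = 0 := by
  have h := LinearMap.congr_fun X.isContraction.nab_proj (Pi.single ∅ x)
  have he := X.e_apply (Pi.single ∅ x)
  rw [Pi.single_eq_same] at he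
  rw [← he]
  exact h

theorem π_horiz (x : M) : X.π (X.horiz x) = X.π x := by
  change X.π (X.e (Pi.single ∅ x) ∅) = X.π x
  rw [e, LinearMap.sub_apply, LinearMap.sub_apply, Module.End.mul_apply X.H, X.δ_single,
    map_zero, sub_zero, Pi.sub_apply, map_sub, Module.End.mul_apply, X.π_δ_apply]
  simp

theorem ker_π_le : LinearMap.ker X.π ≤ LinearMap.ker X.horiz := fun x hx => by
  obtain ⟨y, rfl⟩ := X.ker_π x (LinearMap.mem_ker.1 hx)
  have h := LinearMap.congr_fun X.isContraction.proj_δ (∑ j, wedge S j (Pi.single ∅ (y j)))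
  rw [Module.End.mul_apply, X.δ_sum_wedge] at h
  exact LinearMap.mem_ker.2 (congrFun h ∅)

/-- The horizontal section of `π`. -/
noncomputable def σ : N →ₗ[S] M :=
  (LinearMap.ker X.π).liftQ X.horiz X.ker_π_le ∘ₗ
    (X.π.quotKerEquivOfSurjective X.π_surj).symm.toLinearMap

theorem σ_π (x : M) : X.σ (X.π x) = X.horiz x := by
  have h : (X.π.quotKerEquivOfSurjective X.π_surj).symm (X.π x) = Submodule.Quotient.mk x :=
    (LinearEquiv.symm_apply_eq _).2 rfl
  rw [σ, LinearMap.comp_apply, LinearEquiv.coe_coe, h, Submodule.liftQ_apply]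

/-- The morphism from the quotient to the suspension of `M`. -/
noncomputable def ψ : N →ₗ[S] M :=
  LinearMap.proj Finset.univ ∘ₗ X.Z ∘ₗ LinearMap.single S (fun _ => M) ∅ ∘ₗ X.σ

/-- The morphism from the suspension of `M` to the quotient. -/
def θ : M →ₗ[S] N :=
  X.π ∘ₗ LinearMap.proj ∅ ∘ₗ X.TF ∘ₗ LinearMap.single S (fun _ => M) Finset.univ

theorem θ_apply (x : M) : X.θ x = X.π (X.TF (Pi.single Finset.univ x) ∅) := rfl

theorem ψ_π_apply (f : Finset (Fin n) → M) : X.ψ (X.π (f ∅)) = (X.Z * X.e) f Finset.univ := by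
  rw [Module.End.mul_apply, e_apply, ← X.σ_π]
  rfl

theorem diag_apply_univ (a : Module.End S M) (f : Finset (Fin n) → M) :
    diag (fun k => (-1) ^ k * a) f Finset.univ = (-1 : ℤ) ^ n • a (f Finset.univ) := by
  rw [diag_apply, neg_one_pow_mul_apply, Finset.card_univ, Fintype.card_fin]

theorem diag_apply_empty (a : Module.End S M) (f : Finset (Fin n) → M) :
    diag (fun k => (-1) ^ k * a) f ∅ = a (f ∅) := by
  simp [diag_apply]

theorem diag_single_univ (a : Module.End S M) (x : M) :
    diag (fun k => (-1) ^ k * a) (Pi.single (Finset.univ : Finset (Fin n)) x) =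
      Pi.single Finset.univ ((-1 : ℤ) ^ n • a x) := by
  funext I
  rcases eq_or_ne I Finset.univ with rfl | hI
  · rw [diag_apply_univ, Pi.single_eq_same, Pi.single_eq_same]
  · rw [diag_apply, Pi.single_eq_of_ne hI, Pi.single_eq_of_ne hI, map_zero]

theorem ψ_dQ (y : N) : (-1 : ℤ) ^ n • X.d (X.ψ y) = X.ψ (X.dQ y) := by
  obtain ⟨x, rfl⟩ := X.π_surj y
  have h := X.ψ_π_apply ((X.δ + X.dF) (Pi.single ∅ x))
  rw [← Module.End.mul_apply, ← X.D_Z_e, Module.End.mul_apply, LinearMap.add_apply,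
    LinearMap.add_apply, Pi.add_apply, Pi.add_apply, X.δ_single, X.δ_apply_univ, dF,
    diag_apply_univ, diag_apply_empty, ← X.ψ_π_apply] at h
  simpa [X.π_d] using h.symm

theorem ψ_gQ (y : N) : (-1 : ℤ) ^ n • X.g (X.ψ y) = X.ψ (X.gQ y) := by
  obtain ⟨x, rfl⟩ := X.π_surj y
  have h := X.ψ_π_apply (X.gF (Pi.single ∅ x))
  rw [← Module.End.mul_apply, mul_assoc, X.e_gF, ← mul_assoc, X.Z_gF, mul_assoc,
    Module.End.mul_apply X.gF, gF, diag_apply_univ, diag_apply_empty, ← X.ψ_π_apply] at h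
  simpa [X.π_g] using h.symm

theorem dQ_θ (x : M) : X.dQ (X.θ x) = X.θ ((-1 : ℤ) ^ n • X.d x) := by
  rw [θ_apply, θ_apply, ← diag_single_univ, ← dF, ← Module.End.mul_apply, ← X.D_TF,
    Module.End.mul_apply, LinearMap.add_apply, Pi.add_apply, map_add, X.π_δ_apply, zero_add,
    dF, diag_apply_empty, X.π_d]

theorem gQ_θ (x : M) : X.gQ (X.θ x) = X.θ ((-1 : ℤ) ^ n • X.g x) := by
  rw [θ_apply, θ_apply, ← diag_single_univ, ← gF, ← Module.End.mul_apply, X.T_gF,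
    Module.End.mul_apply, gF, diag_apply_empty, X.π_g]

/-- The homotopy from `ψ ∘ θ` to the identity. -/
def hom : Module.End S M :=
  -(LinearMap.proj Finset.univ ∘ₗ (X.Z * X.H * X.TF) ∘ₗ LinearMap.single S (fun _ => M) Finset.univ)

theorem hom_apply (x : M) :
    X.hom x = -(X.Z * X.H * X.TF) (Pi.single Finset.univ x) Finset.univ := rfl

theorem ψ_θ_apply (x : M) :
    X.ψ (X.θ x) - x = (-1 : ℤ) ^ n • X.d (X.hom x) + X.hom ((-1 : ℤ) ^ n • X.d x) := by
  have h := congrFun (LinearMap.congr_fun X.one_sub_Z_e (X.TF (Pi.single Finset.univ x)))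
    Finset.univ
  have h1 : X.Z * X.H * (X.δ + X.dF) * X.TF = X.Z * X.H * X.TF * X.dF := by
    rw [mul_assoc, X.D_TF, mul_assoc, mul_assoc, mul_assoc]
  rw [LinearMap.sub_apply, Pi.sub_apply, Module.End.one_apply, X.T_apply_univ,
    Pi.single_eq_same, ← X.ψ_π_apply, ← X.θ_apply, LinearMap.add_apply, Pi.add_apply,
    ← Module.End.mul_apply (X.Z * X.H * _) X.TF, h1, Module.End.mul_apply (X.δ + X.dF),
    LinearMap.add_apply, Pi.add_apply, X.δ_apply_univ, zero_add, Module.End.mul_apply _ X.dF, dF,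
    diag_apply_univ, diag_single_univ, ← Module.End.mul_apply _ X.TF] at h
  rw [hom_apply, hom_apply, ← neg_sub, h, map_neg, smul_neg, neg_add]

theorem θ_ψ_apply {lamQ : Fin n → Module.End S N} (hlam : ∀ j x, X.π (X.lam j x) = lamQ j (X.π x))
    (y : N) : (n.factorial : ℤ) • X.θ (X.ψ y) = (-1 : ℤ) ^ (n * (n + 1) / 2) •
      (List.ofFn lamQ).prod ((-1 : ℤ) ^ n • ∑ τ : Equiv.Perm (Fin n),
        (Equiv.Perm.sign τ : ℤ) • (List.ofFn fun k => X.comQ (τ k)).prod y) := by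
  have h : (n.factorial : ℤ) • X.π (X.ψ y) = (-1 : ℤ) ^ (n * (n + 1) / 2) •
      ∑ τ : Equiv.Perm (Fin n), (Equiv.Perm.sign τ : ℤ) •
        (List.ofFn fun k => X.comQ (τ k)).prod y := by
    obtain ⟨x, rfl⟩ := X.π_surj y
    rw [← oneForm_pow_apply, ← X.π_horiz x,
      ← X.π_F_pow_single (X.nab_single_horiz x) n _ (by simp), ← Z_single_univ, X.π_horiz,
      ← X.σ_π]
    rfl
  rw [θ_apply, X.TF_single_univ, map_zsmul, List.ofFn_eq_map, map_list_prod_apply hlam,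
    ← List.ofFn_eq_map, smul_comm, ← map_zsmul, h, map_zsmul, map_zsmul, smul_comm]

end PushforwardData

theorem apply_eq_sum_dmat {R : Type*} [CommRing R] {ι : Type*} [Fintype ι] [DecidableEq ι]
    (d : Module.End R (ι → R)) (x : ι → R) (a : ι) : d x a = ∑ b, dmat d a b * x b := by
  conv_lhs => rw [pi_eq_sum_univ' x, map_sum, Finset.sum_apply]
  refine Finset.sum_congr rfl fun b _ => ?_
  rw [map_smul, Pi.smul_apply, smul_eq_mul, mul_comm, dmat]

theorem matExt_dmat_mk {R : Type*} [CommRing R] {ι : Type*} [Fintype ι] [DecidableEq ι]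
    (I : Ideal R) (d : Module.End R (ι → R)) (x : ι → R) :
    (fun a => Ideal.Quotient.mk I (d x a)) =
      (matExt (dmat d) : Module.End R (ι → R ⧸ I)) fun a => Ideal.Quotient.mk I (x a) := by
  funext a
  rw [apply_eq_sum_dmat, map_sum, matExt, LinearMap.pi_apply, LinearMap.sum_apply]
  exact Finset.sum_congr rfl fun b _ => map_mul _ _ _

theorem gX_apply {R : Type*} [CommRing R] {ι : Type*} [Fintype ι] [DecidableEq ι]
    (par : ι → Bool) (x : ι → R) (a : ι) :
    gX R par x a = (if par a then (-1 : R) else 1) * x a := rfl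

/-- Division by a nonzero integer in a module over a `ℚ`-algebra. -/
theorem eq_algebraMap_div_smul {S N : Type*} [CommRing S] [Algebra ℚ S] [AddCommGroup N]
    [Module S N] {a b : ℤ} (hb : b ≠ 0) {x y : N} (h : b • x = a • y) :
    x = algebraMap ℚ S (a / b) • y := by
  have h1 : ∀ (c : ℤ) (z : N), c • z = algebraMap ℚ S c • z := fun c z => by
    rw [map_intCast, Int.cast_smul_eq_zsmul]
  have hb' : (b : ℚ) ≠ 0 := Int.cast_ne_zero.2 hb
  rw [div_eq_inv_mul, map_mul, mul_smul, ← h1, ← h, h1, ← mul_smul, ← map_mul,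
    inv_mul_cancel₀ hb', map_one, one_smul]

end Stmt11

open Stmt11 in
theorem statement11
    {S R : Type*} [CommRing S] [CommRing R] [Algebra ℚ S] [Algebra S R] (W : S) {n : ℕ}
    -- X a finite rank matrix factorisation of φ(W) over R with homogeneous basis
    {ι : Type*} [Fintype ι] [DecidableEq ι] (par : ι → Bool)
    (d : Module.End R (ι → R))
    (hd_odd : d * gX R par = -(gX R par * d))
    (hd_sq : d * d = algebraMap S R W • (1 : Module.End R (ι → R)))
    -- a quasi-regular sequence with R/tR finitely generated projective over S
    (u : Fin n → R) (hqreg : IsQuasiRegular u)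
    (hfin : Module.Finite S (R ⧸ Ideal.span (Set.range u)))
    (hproj : Module.Projective S (R ⧸ Ideal.span (Set.range u)))
    -- odd homotopies λⱼ with λⱼd + dλⱼ = tⱼ·1
    (lam : Fin n → Module.End R (ι → R))
    (hlam_odd : ∀ j, lam j * gX R par = -(gX R par * lam j))
    (hlam : ∀ j, lam j * d + d * lam j = u j • (1 : Module.End R (ι → R)))
    -- a standard flat S-linear connection on R over S[t], with Ker(∇⁰) + tR = R
    (dd : Fin n → (R →ₗ[S] R))
    (hleib : ∀ i j r, dd j (u i * r) = u i * dd j r + (if i = j then r else 0))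
    (hflat : ∀ i j, dd i ∘ₗ dd j = dd j ∘ₗ dd i)
    (hstd_bij : ∀ p : ℕ, 0 < p →
      Function.Bijective (p • (LinearMap.id : R →ₗ[S] R) + delNabla0 u dd))
    (hstd_ideal : ∀ p : ℕ, 0 < p →
      Submodule.map (p • (LinearMap.id : R →ₗ[S] R) + delNabla0 u dd)
        ((Ideal.span (Set.range u)).restrictScalars S) =
        (Ideal.span (Set.range u)).restrictScalars S)
    (hstd_im : LinearMap.range (delNabla0 u dd) =
      (Ideal.span (Set.range u)).restrictScalars S)
    (hker : (⨅ j, LinearMap.ker (dd j)) ⊔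
      (Ideal.span (Set.range u)).restrictScalars S = ⊤)
    -- the descended commutators [∂ⱼ, a] on R/tR
    (C : Fin n → R → Module.End S (R ⧸ Ideal.span (Set.range u)))
    (hC : ∀ (j : Fin n) (a x : R),
      C j a (Ideal.Quotient.mk (Ideal.span (Set.range u)) x) =
        Ideal.Quotient.mk (Ideal.span (Set.range u)) (dd j (a * x) - a * dd j x)) :
    -- data of the statement
    let Q := R ⧸ Ideal.span (Set.range u)
    let DQ : Module.End R (ι → Q) := matExt (dmat d)            -- differential of X/tX
    let GQ : Module.End R (ι → Q) :=
      matExt (dmat (gX R par))                                  -- grading of X/tX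
    let Dn : Module.End R (ι → R) := ((-1 : R) ^ n) • d         -- differential of X[n]
    let Gn : Module.End R (ι → R) := ((-1 : R) ^ n) • gX R par  -- grading of X[n]
    -- Atⁿ (trivialised by dt₁∧⋯∧dtₙ) as an S-linear endomorphism of X/tX
    let AtQ : Module.End S (ι → Q) :=
      ((-1 : ℤ) ^ n) •
        ∑ τ : Equiv.Perm (Fin n),
          (Equiv.Perm.sign τ : ℤ) •
            ((List.ofFn fun kk =>
              (LinearMap.pi fun a => ∑ b, C (τ kk) (dmat d a b) ∘ₗ LinearMap.proj b :
                Module.End S (ι → Q))).prod)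
    -- e = (1/n!)(-1)^{n(n+1)/2} λ₁⋯λₙ ∘ Atⁿ
    let e : Module.End S (ι → Q) :=
      algebraMap ℚ S (((-1 : ℚ) ^ (n * (n + 1) / 2)) / (n.factorial : ℚ)) •
        (((List.ofFn fun j =>
            (matExt (dmat (lam j)) : Module.End R (ι → Q))).prod).restrictScalars S *
          AtQ)
    -- the statement: there are morphisms ψ : X/tX → φ_*(X)[n] and θ : φ_*(X)[n] → X/tX
    -- in the homotopy category of linear factorisations of W over S with ψθ = 1 and
    -- θψ = e; in particular φ_*(X)[n] is a direct summand of X/tX.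
    ∃ (ψ : (ι → Q) →ₗ[S] (ι → R)) (θ : (ι → R) →ₗ[S] (ι → Q)),
      (Gn.restrictScalars S ∘ₗ ψ = ψ ∘ₗ GQ.restrictScalars S) ∧
      (Dn.restrictScalars S ∘ₗ ψ = ψ ∘ₗ DQ.restrictScalars S) ∧
      (GQ.restrictScalars S ∘ₗ θ = θ ∘ₗ Gn.restrictScalars S) ∧
      (DQ.restrictScalars S ∘ₗ θ = θ ∘ₗ Dn.restrictScalars S) ∧
      (∃ Hm : (ι → R) →ₗ[S] (ι → R),
        ψ ∘ₗ θ - LinearMap.id =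
          Dn.restrictScalars S ∘ₗ Hm + Hm ∘ₗ Dn.restrictScalars S) ∧
      (∃ Hm' : (ι → Q) →ₗ[S] (ι → Q),
        θ ∘ₗ ψ - e =
          DQ.restrictScalars S ∘ₗ Hm' + Hm' ∘ₗ DQ.restrictScalars S) := by
  intro Q DQ GQ Dn Gn AtQ e
  have hpow : ∀ (f : Module.End R (ι → R)) (x : ι → R),
      (((-1 : R) ^ n) • f) x = (-1 : ℤ) ^ n • f x := fun f x => by
    rcases Nat.even_or_odd n with h | h <;> simp [h.neg_one_pow]
  have hlap : ∀ k : ℕ, (k + ∑ i, (LinearMap.mulLeft S (u i)).compLeft ι * (dd i).compLeft ι :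
      Module.End S (ι → R)) =
        (k • (LinearMap.id : R →ₗ[S] R) + delNabla0 u dd).compLeft ι := fun k => by
    refine LinearMap.ext fun x => funext fun a => ?_
    simp [delNabla0, LinearMap.sum_apply]
  let X : PushforwardData S (ι → R) (ι → Q) n :=
    { W := W
      d := d.restrictScalars S
      g := (gX R par).restrictScalars S
      u := fun i => (LinearMap.mulLeft S (u i)).compLeft ι
      del := fun j => (dd j).compLeft ι
      lam := fun j => (lam j).restrictScalars S
      inv := fun k => if hk : 0 < k then
        (LinearEquiv.ofBijective _ (hstd_bij k hk)).symm.toLinearMap.compLeft ι else 0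
      π := (Ideal.Quotient.mkₐ S (Ideal.span (Set.range u))).toLinearMap.compLeft ι
      dQ := DQ.restrictScalars S
      gQ := GQ.restrictScalars S
      comQ := fun j => LinearMap.pi fun a => ∑ b, C j (dmat d a b) ∘ₗ LinearMap.proj b
      d_d := LinearMap.ext fun x => by
        have h := LinearMap.congr_fun hd_sq x
        simpa using h
      d_g := LinearMap.ext fun x => LinearMap.congr_fun hd_odd x
      lam_g := fun j => LinearMap.ext fun x => LinearMap.congr_fun (hlam_odd j) x
      lam_d := fun j => LinearMap.ext fun x => LinearMap.congr_fun (hlam j) x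
      u_u := fun i j => LinearMap.ext fun x => funext fun a => mul_left_comm _ _ _
      u_d := fun i => LinearMap.ext fun x => (d.map_smul (u i) x).symm
      u_g := fun i => LinearMap.ext fun x => ((gX R par).map_smul (u i) x).symm
      u_lam := fun i j => LinearMap.ext fun x => ((lam j).map_smul (u i) x).symm
      del_g := fun j => LinearMap.ext fun x => funext fun a => by
        change dd j (gX R par x a) = gX R par (fun b => dd j (x b)) a
        rw [gX_apply, gX_apply]
        split_ifs <;> simp
      del_u := fun j i => LinearMap.ext fun x => funext fun a => by
        refine (hleib i j (x a)).trans ?_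
        split_ifs <;> rfl
      del_del := fun i j => LinearMap.ext fun x => funext fun a =>
        LinearMap.congr_fun (hflat i j) (x a)
      inv_mul := fun k hk => by
        rw [hlap, dif_pos hk]
        exact LinearMap.ext fun x => funext fun a =>
          (LinearEquiv.ofBijective _ (hstd_bij k hk)).symm_apply_apply (x a)
      mul_inv := fun k hk => by
        rw [hlap, dif_pos hk]
        exact LinearMap.ext fun x => funext fun a =>
          (LinearEquiv.ofBijective _ (hstd_bij k hk)).apply_symm_apply (x a)
      π_surj := fun y => by
        choose x hx using fun a => Ideal.Quotient.mk_surjective (y a)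
        exact ⟨x, funext hx⟩
      π_u := fun i x => funext fun a => Ideal.Quotient.eq_zero_iff_mem.2
        (Ideal.mul_mem_right _ _ (Ideal.subset_span ⟨i, rfl⟩))
      ker_π := fun x hx => by
        choose c hc using fun a => Ideal.mem_span_range_iff_exists_fun.1
          (Ideal.Quotient.eq_zero_iff_mem.1 (congrFun hx a))
        refine ⟨fun i a => c a i, funext fun a => ?_⟩
        rw [Finset.sum_apply, ← hc]
        exact Finset.sum_congr rfl fun i _ => mul_comm _ _
      π_d := matExt_dmat_mk _ d
      π_g := matExt_dmat_mk _ (gX R par)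
      π_com := fun j x => funext fun a => by
        change Ideal.Quotient.mk _ (dd j (d x a) - d (fun b => dd j (x b)) a) = _
        rw [apply_eq_sum_dmat, apply_eq_sum_dmat, map_sum, ← Finset.sum_sub_distrib, map_sum,
          LinearMap.pi_apply, LinearMap.sum_apply]
        exact Finset.sum_congr rfl fun b _ => (hC j _ _).symm }
  refine ⟨X.ψ, X.θ, LinearMap.ext fun y => ?_, LinearMap.ext fun y => ?_,
    LinearMap.ext fun x => ?_, LinearMap.ext fun x => ?_,
    ⟨X.hom, LinearMap.ext fun x => ?_⟩, ⟨0, ?_⟩⟩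
  · exact (hpow _ _).trans (X.ψ_gQ y)
  · exact (hpow _ _).trans (X.ψ_dQ y)
  · exact (X.gQ_θ x).trans (congrArg X.θ (hpow _ _).symm)
  · exact (X.dQ_θ x).trans (congrArg X.θ (hpow _ _).symm)
  · have h := X.ψ_θ_apply x
    exact h.trans (congrArg₂ _ (hpow _ _).symm (congrArg X.hom (hpow _ _).symm))
  · rw [LinearMap.comp_zero, LinearMap.zero_comp, add_zero, sub_eq_zero]
    refine LinearMap.ext fun y => ?_
    have h := X.θ_ψ_apply (lamQ := fun j => (matExt (dmat (lam j)) :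
      Module.End R (ι → Q)).restrictScalars S) (fun j => matExt_dmat_mk _ (lam j)) y
    have hprod := map_list_prod_apply (A := S) (B := R)
      (π := (LinearMap.id : (ι → Q) →ₗ[S] (ι → Q)))
      (a := fun j => (matExt (dmat (lam j)) : Module.End R (ι → Q)).restrictScalars S)
      (b := fun j => (matExt (dmat (lam j)) : Module.End R (ι → Q))) (fun j x => rfl)
      (List.finRange n)
    rw [← List.ofFn_eq_map, ← List.ofFn_eq_map] at hprod
    refine (eq_algebraMap_div_smul (S := S) (mod_cast n.factorial_ne_zero) h).trans ?_
    simp only [LinearMap.id_apply] at hprod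
    rw [hprod]
    push_cast
    simp only [e, AtQ, LinearMap.smul_apply, Module.End.mul_apply, LinearMap.sum_apply]
    rfl
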